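/- Let K = u/v be shift-reduced with K ≠ 1, and let S ∈ F(y). Then there exist f ∈ F(y) and a residual form r with respect to K such that S = K·σ(f) − f + r. Moreover, S belongs to V_K if and only if r = 0. -/

import Mathlib

open Polynomial

noncomputable def pshift (F : Type*) [Field F] (i : ℤ) :
    Polynomial F →ₐ[F] Polynomial F :=
  aeval (X + C (i : F))

noncomputable def rshift (F : Type*) [Field F] (i : ℤ) : RatFunc F → RatFunc F :=
  fun f => RatFunc.mk (pshift F i f.num) (pshift F i f.denom)

def shiftFree {F : Type*} [Field F] (p : Polynomial F) : Prop :=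
  p ≠ 0 ∧ ∀ i : ℤ, i ≠ 0 → IsCoprime p (pshift F i p)

def shiftReducedPair {F : Type*} [Field F] (u v : Polynomial F) : Prop :=
  u ≠ 0 ∧ v ≠ 0 ∧ IsCoprime u v ∧ ∀ i : ℤ, IsCoprime u (pshift F i v)

def stronglyPrime {F : Type*} [Field F] (p u v : Polynomial F) : Prop :=
  p ≠ 0 ∧ ∀ i : ℕ, IsCoprime p (pshift F (-(i : ℤ)) u) ∧ IsCoprime p (pshift F (i : ℤ) v)

noncomputable def phiK {F : Type*} [Field F] (u v : Polynomial F) :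
    Polynomial F → Polynomial F :=
  fun p => u * pshift F 1 p - v * p

noncomputable def WK (F : Type*) [Field F] (u v : Polynomial F) :
    Submodule F (Polynomial F) :=
  Submodule.span F {q : Polynomial F | ∃ ℓ : ℕ, q = X ^ ℓ ∧
    ∀ w : Polynomial F, w ∈ Set.range (phiK u v) → w ≠ 0 → ℓ ≠ w.natDegree}

def VK {F : Type*} [Field F] (K : RatFunc F) : Set (RatFunc F) :=
  {g | ∃ r : RatFunc F, g = K * rshift F 1 r - r}

def residualForm {F : Type*} [Field F] (u v : Polynomial F) (r : RatFunc F) : Prop :=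
  ∃ a b q : Polynomial F, a.degree < b.degree ∧ shiftFree b ∧ stronglyPrime b u v ∧
    q ∈ WK F u v ∧ r = RatFunc.mk a b + RatFunc.mk q v

section Shift

variable {F : Type*} [Field F]

theorem pshift_eq_taylor (i : ℤ) (p : F[X]) : pshift F i p = taylor (i : F) p := by
  rw [taylor_apply, comp_eq_aeval]; rfl

theorem pshift_pshift (i j : ℤ) (p : F[X]) :
    pshift F i (pshift F j p) = pshift F (i + j) p := by
  simp only [pshift_eq_taylor, taylor_taylor, Int.cast_add]

theorem pshift_zero (p : F[X]) : pshift F 0 p = p := by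
  simp [pshift_eq_taylor]

theorem pshift_injective (i : ℤ) : Function.Injective (pshift F i) := fun p q h => by
  simpa only [pshift_eq_taylor, taylor_inj] using h

theorem pshift_ne_zero (i : ℤ) {p : F[X]} (hp : p ≠ 0) : pshift F i p ≠ 0 :=
  (map_ne_zero_iff _ (pshift_injective i)).2 hp

theorem IsCoprime.pshift (i : ℤ) {p q : F[X]} (h : IsCoprime p q) :
    IsCoprime (_root_.pshift F i p) (_root_.pshift F i q) :=
  h.map (_root_.pshift F i).toRingHom

theorem isCoprime_pshift_iff (i : ℤ) {p q : F[X]} :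
    IsCoprime (pshift F i p) (pshift F i q) ↔ IsCoprime p q := by
  refine ⟨fun h => ?_, fun h => h.pshift i⟩
  simpa [pshift_pshift, pshift_zero] using h.pshift (-i)

theorem pshift_dvd_pshift (i : ℤ) {p q : F[X]} (h : p ∣ q) : pshift F i p ∣ pshift F i q := by
  obtain ⟨c, rfl⟩ := h
  exact ⟨pshift F i c, map_mul _ _ _⟩

theorem irreducible_pshift (i : ℤ) {p : F[X]} (hp : Irreducible p) :
    Irreducible (pshift F i p) := by
  have h : pshift F i p = taylorEquiv (i : F) p := pshift_eq_taylor i p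
  rw [h]
  exact (MulEquiv.irreducible_iff (taylorEquiv (i : F))).2 hp

theorem natDegree_eq_zero_of_pshift_eq_self [CharZero F] {i : ℤ} (hi : i ≠ 0) {p : F[X]}
    (h : pshift F i p = p) : p.natDegree = 0 := by
  have hper : ∀ x : F, p.eval (x + i) = p.eval x := fun x => by
    conv_rhs => rw [← h, pshift_eq_taylor, taylor_eval]
  have hn : ∀ n : ℕ, p.eval ((n : F) * i) = p.eval 0 := fun n => by
    induction n with
    | zero => simp
    | succ n ih => rw [Nat.cast_succ, add_mul, one_mul, hper, ih]
  have hinj : Function.Injective fun n : ℕ => (n : F) * i := fun m n hmn =>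
    Nat.cast_injective (mul_right_cancel₀ (Int.cast_ne_zero.2 hi) hmn)
  have : p = C (p.eval 0) := by
    refine eq_of_infinite_eval_eq _ _ ((Set.infinite_range_of_injective hinj).mono ?_)
    rintro _ ⟨n, rfl⟩
    simpa using hn n
  rw [this, natDegree_C]

theorem Irreducible.isCoprime_pshift [CharZero F] {p : F[X]} (hp : Irreducible p) {i : ℤ}
    (hi : i ≠ 0) : IsCoprime p (_root_.pshift F i p) := by
  rw [hp.coprime_iff_not_dvd]
  intro hdvd
  have heq := eq_of_dvd_of_natDegree_le_of_leadingCoeff hdvd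
    (by rw [pshift_eq_taylor, natDegree_taylor]) (by rw [pshift_eq_taylor, leadingCoeff_taylor])
  exact hp.natDegree_pos.ne' (natDegree_eq_zero_of_pshift_eq_self hi heq.symm)

theorem finite_setOf_pshift_dvd [CharZero F] {p w : F[X]} (hp : Irreducible p) (hw : w ≠ 0) :
    {i : ℤ | pshift F i p ∣ w}.Finite := by
  classical
  have h : ∀ i : ℤ, pshift F i p ∣ w →
      ∃ q ∈ UniqueFactorizationMonoid.factors w, Associated (pshift F i p) q := fun i hi =>
    UniqueFactorizationMonoid.exists_mem_factors_of_dvd hw (irreducible_pshift i hp) hi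
  choose! g hg hassoc using h
  refine Set.Finite.of_finite_image (f := g)
    ((UniqueFactorizationMonoid.factors w).toFinset.finite_toSet.subset ?_) ?_
  · rintro _ ⟨i, hi, rfl⟩
    simpa using hg i hi
  · intro i hi j hj hij
    by_contra hne
    have hij' : Associated (pshift F i p) (pshift F j p) :=
      (hassoc i hi).trans (hij ▸ (hassoc j hj).symm)
    have hcop := (hp.isCoprime_pshift (sub_ne_zero.2 (Ne.symm hne))).pshift i
    rw [pshift_pshift, add_sub_cancel] at hcop
    exact (irreducible_pshift i hp).not_isUnit (hcop.isUnit_of_dvd' dvd_rfl hij'.dvd)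

theorem exists_max_pshift_dvd [CharZero F] {p w : F[X]} (hp : Irreducible p) (hw : w ≠ 0)
    (hpw : p ∣ w) : ∃ i : ℤ, 0 ≤ i ∧ pshift F i p ∣ w ∧ ∀ j, i < j → ¬ pshift F j p ∣ w := by
  have hfin := finite_setOf_pshift_dvd hp hw
  have h0 : (0 : ℤ) ∈ {i : ℤ | pshift F i p ∣ w} := by simpa [pshift_zero] using hpw
  obtain ⟨i, hi, hmax⟩ := hfin.exists_maximal ⟨0, h0⟩
  refine ⟨i, ?_, hi, fun j hj hdvd => absurd (hmax hdvd hj.le) (not_le.2 hj)⟩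
  by_contra hneg
  exact absurd (hmax h0 (not_le.1 hneg).le) hneg

theorem exists_min_pshift_dvd [CharZero F] {p w : F[X]} (hp : Irreducible p) (hw : w ≠ 0)
    (hpw : p ∣ w) : ∃ i : ℤ, i ≤ 0 ∧ pshift F i p ∣ w ∧ ∀ j, j < i → ¬ pshift F j p ∣ w := by
  have hfin := finite_setOf_pshift_dvd hp hw
  have h0 : (0 : ℤ) ∈ {i : ℤ | pshift F i p ∣ w} := by simpa [pshift_zero] using hpw
  obtain ⟨i, hi, hmin⟩ := hfin.exists_minimal ⟨0, h0⟩
  refine ⟨i, ?_, hi, fun j hj hdvd => absurd (hmin hdvd hj.le) (not_le.2 hj)⟩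
  by_contra hneg
  exact absurd (hmin h0 (not_le.1 hneg).le) hneg

theorem stronglyPrime.of_dvd {p q u v : F[X]} (h : stronglyPrime q u v) (hpq : p ∣ q) :
    stronglyPrime p u v :=
  ⟨ne_zero_of_dvd_ne_zero h.1 hpq, fun i =>
    ⟨(h.2 i).1.of_isCoprime_of_dvd_left hpq, (h.2 i).2.of_isCoprime_of_dvd_left hpq⟩⟩

theorem stronglyPrime.mul {p q u v : F[X]} (hp : stronglyPrime p u v)
    (hq : stronglyPrime q u v) : stronglyPrime (p * q) u v :=
  ⟨mul_ne_zero hp.1 hq.1, fun i =>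
    ⟨(hp.2 i).1.mul_left (hq.2 i).1, (hp.2 i).2.mul_left (hq.2 i).2⟩⟩

theorem stronglyPrime_one (u v : F[X]) : stronglyPrime 1 u v :=
  ⟨one_ne_zero, fun _ => ⟨isCoprime_one_left, isCoprime_one_left⟩⟩

theorem stronglyPrime.pow {p u v : F[X]} (hp : stronglyPrime p u v) (m : ℕ) :
    stronglyPrime (p ^ m) u v :=
  ⟨pow_ne_zero m hp.1, fun i => ⟨(hp.2 i).1.pow_left, (hp.2 i).2.pow_left⟩⟩

theorem shiftFree_one : shiftFree (1 : F[X]) :=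
  ⟨one_ne_zero, fun _ _ => isCoprime_one_left⟩

theorem shiftFree.of_dvd {p q : F[X]} (h : shiftFree q) (hpq : p ∣ q) : shiftFree p :=
  ⟨ne_zero_of_dvd_ne_zero h.1 hpq, fun i hi =>
    ((h.2 i hi).of_isCoprime_of_dvd_left hpq).of_isCoprime_of_dvd_right
      (pshift_dvd_pshift i hpq)⟩

theorem shiftFree.pow {p : F[X]} (h : shiftFree p) (m : ℕ) : shiftFree (p ^ m) :=
  ⟨pow_ne_zero m h.1, fun i hi => by rw [map_pow]; exact (h.2 i hi).pow⟩

/-- If an irreducible polynomial `p` shares no factor with any shift of a shift-free `b`,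
then the product with any shift of `p` is again shift-free. -/
theorem shiftFree.mul_pshift [CharZero F] {b p : F[X]} (hb : shiftFree b) (hp : Irreducible p)
    (h : ∀ i : ℤ, ¬ pshift F i p ∣ b) (k : ℤ) : shiftFree (b * pshift F k p) := by
  have hcop : ∀ i : ℤ, IsCoprime (pshift F i p) b := fun i =>
    (irreducible_pshift i hp).coprime_iff_not_dvd.2 (h i)
  refine ⟨mul_ne_zero hb.1 (irreducible_pshift k hp).ne_zero, fun i hi => ?_⟩
  rw [map_mul]
  refine .mul_left (.mul_right (hb.2 i hi) ?_)
    (.mul_right ?_ ((irreducible_pshift k hp).isCoprime_pshift hi))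
  · rw [pshift_pshift]
    exact (hcop _).symm
  · have := (hcop (k - i)).pshift i
    rwa [pshift_pshift, add_sub_cancel] at this

theorem exists_stronglyPrime_pshift [CharZero F] {u v p : F[X]} (hsr : shiftReducedPair u v)
    (hp : Irreducible p) : ∃ i : ℤ, stronglyPrime (pshift F i p) u v := by
  obtain ⟨hu, hv, -, huv⟩ := hsr
  have key : ∀ (i k : ℤ) (w : F[X]), ¬ pshift F (i - k) p ∣ w →
      IsCoprime (pshift F i p) (pshift F k w) := fun i k w h => by
    have := ((irreducible_pshift (i - k) hp).coprime_iff_not_dvd.2 h).pshift k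
    rwa [pshift_pshift, add_sub_cancel] at this
  by_cases h : ∃ j : ℤ, pshift F j p ∣ u
  · obtain ⟨j, hj⟩ := h
    have hv' : ∀ i : ℤ, ¬ pshift F i p ∣ v := fun i hi => by
      have h1 := pshift_dvd_pshift (j - i) hi
      rw [pshift_pshift, sub_add_cancel] at h1
      exact (irreducible_pshift j hp).not_isUnit ((huv (j - i)).isUnit_of_dvd' hj h1)
    obtain ⟨N, hN⟩ := (finite_setOf_pshift_dvd hp hu).bddAbove
    refine ⟨N + 1, (irreducible_pshift _ hp).ne_zero, fun i => ⟨key _ _ _ fun hd => ?_,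
      key _ _ _ (hv' _)⟩⟩
    have := hN hd
    omega
  · push Not at h
    obtain ⟨N, hN⟩ := (finite_setOf_pshift_dvd hp hv).bddBelow
    refine ⟨N - 1, (irreducible_pshift _ hp).ne_zero, fun i => ⟨key _ _ _ (h _),
      key _ _ _ fun hd => ?_⟩⟩
    have := hN hd
    omega

/-- Every irreducible polynomial has a shift that can be adjoined to `b` while keeping `b`
shift-free and strongly prime with `u / v`. -/
theorem exists_pshift_shiftFree_mul [CharZero F] {u v b p : F[X]}
    (hsr : shiftReducedPair u v) (hb : shiftFree b) (hbs : stronglyPrime b u v)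
    (hp : Irreducible p) :
    ∃ i : ℤ, stronglyPrime (pshift F i p) u v ∧ shiftFree (b * pshift F i p) := by
  by_cases h : ∃ i : ℤ, pshift F i p ∣ b
  · obtain ⟨i, hi⟩ := h
    refine ⟨i, hbs.of_dvd hi, (hb.pow 2).of_dvd ?_⟩
    rw [sq]
    exact mul_dvd_mul_left b hi
  · push Not at h
    obtain ⟨i, hi⟩ := exists_stronglyPrime_pshift hsr hp
    exact ⟨i, hi, hb.mul_pshift hp h i⟩

end Shift

section RationalShift

variable {F : Type*} [Field F]

/-- The shift automorphism of the field of rational functions, as a ring homomorphism. -/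
noncomputable def ratShift (F : Type*) [Field F] : RatFunc F →+* RatFunc F :=
  RatFunc.mapRingHom (pshift F 1)
    (nonZeroDivisors_le_comap_nonZeroDivisors_of_injective _ (pshift_injective 1))

theorem rshift_one_eq_ratShift (f : RatFunc F) : rshift F 1 f = ratShift F f := by
  rw [ratShift, RatFunc.coe_mapRingHom_eq_coe_map, RatFunc.map_apply, rshift, RatFunc.mk_eq_div]

theorem ratShift_algebraMap (p : F[X]) :
    ratShift F (algebraMap F[X] (RatFunc F) p) = algebraMap F[X] (RatFunc F) (pshift F 1 p) := by
  have := RatFunc.map_apply_div (pshift F 1)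
    (nonZeroDivisors_le_comap_nonZeroDivisors_of_injective _ (pshift_injective 1)) p 1
  simpa [ratShift, RatFunc.coe_mapRingHom_eq_coe_map] using this

theorem algebraMap_ratFunc_ne_zero {p : F[X]} (hp : p ≠ 0) :
    algebraMap F[X] (RatFunc F) p ≠ 0 :=
  RatFunc.algebraMap_ne_zero hp

/-- `S` and `S'` agree modulo `V_K` and fractions with denominator `v`, where `K = u / v`. -/
def ReducesTo (u v : F[X]) (S S' : RatFunc F) : Prop :=
  ∃ (f : RatFunc F) (q : F[X]),
    S = algebraMap F[X] (RatFunc F) u / algebraMap F[X] (RatFunc F) v * ratShift F f - f + S' +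
      algebraMap F[X] (RatFunc F) q / algebraMap F[X] (RatFunc F) v

theorem ReducesTo.refl (u v : F[X]) (S : RatFunc F) : ReducesTo u v S S :=
  ⟨0, 0, by simp⟩

theorem ReducesTo.trans {u v : F[X]} {S S' S'' : RatFunc F} (h : ReducesTo u v S S')
    (h' : ReducesTo u v S' S'') : ReducesTo u v S S'' := by
  obtain ⟨f, q, rfl⟩ := h
  obtain ⟨f', q', rfl⟩ := h'
  exact ⟨f + f', q + q', by simp only [map_add]; ring⟩

theorem ReducesTo.add {u v : F[X]} {S S' R R' : RatFunc F} (h : ReducesTo u v S S')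
    (h' : ReducesTo u v R R') : ReducesTo u v (S + R) (S' + R') := by
  obtain ⟨f, q, rfl⟩ := h
  obtain ⟨f', q', rfl⟩ := h'
  exact ⟨f + f', q + q', by simp only [map_add]; ring⟩

theorem reducesTo_algebraMap {u v : F[X]} (hv : v ≠ 0) (p : F[X]) :
    ReducesTo u v (algebraMap F[X] (RatFunc F) p) 0 := by
  have hv' := algebraMap_ratFunc_ne_zero hv
  exact ⟨0, p * v, by simp only [map_zero, map_mul]; field_simp; ring⟩

theorem reducesTo_pshift_one {u v D : F[X]} (hv : v ≠ 0) (hD : D ≠ 0)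
    (h : IsCoprime (pshift F 1 D) v) (c : F[X]) : ∃ c' : F[X],
    ReducesTo u v (algebraMap F[X] (RatFunc F) c / algebraMap F[X] (RatFunc F) D)
      (algebraMap F[X] (RatFunc F) c' / algebraMap F[X] (RatFunc F) (pshift F 1 D)) := by
  obtain ⟨x, y, hxy⟩ := h
  have hv' := algebraMap_ratFunc_ne_zero hv
  have hD' := algebraMap_ratFunc_ne_zero (pshift_ne_zero 1 hD)
  have hxy' := congrArg (algebraMap F[X] (RatFunc F)) hxy
  simp only [map_add, map_mul, map_one] at hxy'
  refine ⟨u * pshift F 1 c * y,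
    -(algebraMap F[X] (RatFunc F) c / algebraMap F[X] (RatFunc F) D), u * pshift F 1 c * x, ?_⟩
  simp only [map_neg, map_div₀, ratShift_algebraMap, map_mul]
  field_simp
  linear_combination (-(algebraMap F[X] (RatFunc F) u *
    algebraMap F[X] (RatFunc F) (pshift F 1 c))) * hxy'

theorem reducesTo_pshift_neg_one {u v D : F[X]} (hu : u ≠ 0) (hv : v ≠ 0) (hD : D ≠ 0)
    (h : IsCoprime D u) (c : F[X]) : ∃ c' : F[X],
    ReducesTo u v (algebraMap F[X] (RatFunc F) c / algebraMap F[X] (RatFunc F) D)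
      (algebraMap F[X] (RatFunc F) c' / algebraMap F[X] (RatFunc F) (pshift F (-1) D)) := by
  obtain ⟨x, y, hxy⟩ := h
  have hu' := algebraMap_ratFunc_ne_zero hu
  have hv' := algebraMap_ratFunc_ne_zero hv
  have hD' := algebraMap_ratFunc_ne_zero hD
  have hD'' := algebraMap_ratFunc_ne_zero (pshift_ne_zero (-1) hD)
  have hxy' := congrArg (algebraMap F[X] (RatFunc F)) hxy
  simp only [map_add, map_mul, map_one] at hxy'
  have hinv : ∀ p : F[X], pshift F 1 (pshift F (-1) p) = p := fun p => by
    rw [pshift_pshift, add_neg_cancel, pshift_zero]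
  refine ⟨pshift F (-1) (v * c * y),
    algebraMap F[X] (RatFunc F) (pshift F (-1) (v * c * y)) /
      algebraMap F[X] (RatFunc F) (pshift F (-1) D), v * c * x, ?_⟩
  simp only [map_div₀, ratShift_algebraMap, hinv]
  simp only [map_mul]
  field_simp
  linear_combination (-(algebraMap F[X] (RatFunc F) c *
    algebraMap F[X] (RatFunc F) (pshift F (-1) D))) * hxy'

theorem reducesTo_pshift_nat {u v : F[X]} (hv : v ≠ 0) (n : ℕ) :
    ∀ {D : F[X]}, D ≠ 0 → stronglyPrime (pshift F n D) u v → ∀ c : F[X], ∃ c' : F[X],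
    ReducesTo u v (algebraMap F[X] (RatFunc F) c / algebraMap F[X] (RatFunc F) D)
      (algebraMap F[X] (RatFunc F) c' / algebraMap F[X] (RatFunc F) (pshift F n D)) := by
  induction n with
  | zero => exact fun _ _ c => ⟨c, by simpa [pshift_zero] using ReducesTo.refl u v _⟩
  | succ n ih =>
    intro D hD hs c
    have hsplit : pshift F (n + 1 : ℕ) D = pshift F n (pshift F 1 D) := by
      rw [pshift_pshift]; push_cast; rfl
    rw [hsplit] at hs ⊢
    obtain ⟨c₁, h₁⟩ := reducesTo_pshift_one (u := u) hv hD
      ((isCoprime_pshift_iff n).1 (hs.2 n).2) c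
    obtain ⟨c₂, h₂⟩ := ih (pshift_ne_zero 1 hD) hs c₁
    exact ⟨c₂, h₁.trans h₂⟩

theorem reducesTo_pshift_neg_nat {u v : F[X]} (hu : u ≠ 0) (hv : v ≠ 0) (n : ℕ) :
    ∀ {D : F[X]}, D ≠ 0 → stronglyPrime (pshift F (-(n : ℤ)) D) u v → ∀ c : F[X], ∃ c' : F[X],
    ReducesTo u v (algebraMap F[X] (RatFunc F) c / algebraMap F[X] (RatFunc F) D)
      (algebraMap F[X] (RatFunc F) c' /
        algebraMap F[X] (RatFunc F) (pshift F (-(n : ℤ)) D)) := by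
  induction n with
  | zero => exact fun _ _ c => ⟨c, by simpa [pshift_zero] using ReducesTo.refl u v _⟩
  | succ n ih =>
    intro D hD hs c
    have hsplit : pshift F (-((n + 1 : ℕ) : ℤ)) D = pshift F (-(n : ℤ)) (pshift F (-1) D) := by
      rw [pshift_pshift]; push_cast; congr 2; ring
    obtain ⟨c₁, h₁⟩ := reducesTo_pshift_neg_one hu hv hD
      ((isCoprime_pshift_iff _).1 (hs.2 (n + 1)).1) c
    rw [hsplit] at hs ⊢
    obtain ⟨c₂, h₂⟩ := ih (pshift_ne_zero (-1) hD) hs c₁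
    exact ⟨c₂, h₁.trans h₂⟩

theorem reducesTo_pshift {u v D : F[X]} (hu : u ≠ 0) (hv : v ≠ 0) (hD : D ≠ 0) {i : ℤ}
    (hs : stronglyPrime (pshift F i D) u v) (c : F[X]) : ∃ c' : F[X],
    ReducesTo u v (algebraMap F[X] (RatFunc F) c / algebraMap F[X] (RatFunc F) D)
      (algebraMap F[X] (RatFunc F) c' / algebraMap F[X] (RatFunc F) (pshift F i D)) := by
  obtain ⟨n, rfl | rfl⟩ := i.eq_nat_or_neg
  · exact reducesTo_pshift_nat hv n hD hs c
  · exact reducesTo_pshift_neg_nat hu hv n hD hs c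

/-- `S` reduces to a fraction whose denominator is shift-free and strongly prime with `u / v`. -/
def HasShell (u v : F[X]) (S : RatFunc F) : Prop :=
  ∃ a b : F[X], shiftFree b ∧ stronglyPrime b u v ∧
    ReducesTo u v S (algebraMap F[X] (RatFunc F) a / algebraMap F[X] (RatFunc F) b)

theorem HasShell.add_algebraMap {u v : F[X]} (hv : v ≠ 0) {S : RatFunc F}
    (hS : HasShell u v S) (p : F[X]) : HasShell u v (S + algebraMap F[X] (RatFunc F) p) := by
  obtain ⟨a, b, hb, hbs, hred⟩ := hS
  exact ⟨a, b, hb, hbs, by simpa using hred.add (reducesTo_algebraMap hv p)⟩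

theorem HasShell.add_div_pow [CharZero F] {u v p : F[X]} (hsr : shiftReducedPair u v)
    (hp : Irreducible p) (m : ℕ) {S : RatFunc F} (hS : HasShell u v S) (c : F[X]) :
    HasShell u v
      (S + algebraMap F[X] (RatFunc F) c / algebraMap F[X] (RatFunc F) (p ^ m)) := by
  obtain ⟨a, b, hb, hbs, hred⟩ := hS
  obtain ⟨i, his, hif⟩ := exists_pshift_shiftFree_mul hsr hb hbs hp
  have hps : stronglyPrime (pshift F i (p ^ m)) u v := by
    rw [map_pow]; exact his.pow m
  obtain ⟨c', hc'⟩ := reducesTo_pshift hsr.1 hsr.2.1 (pow_ne_zero m hp.ne_zero) hps c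
  refine ⟨a * pshift F i (p ^ m) + b * c', b * pshift F i (p ^ m),
    (hif.pow (m + 1)).of_dvd ?_, hbs.mul hps, ?_⟩
  · rw [map_pow, mul_pow]
    exact mul_dvd_mul (dvd_pow_self b m.succ_ne_zero) (pow_dvd_pow _ m.le_succ)
  · have hred' := hred.add hc'
    rwa [div_add_div _ _ (algebraMap_ratFunc_ne_zero hb.1) (algebraMap_ratFunc_ne_zero hps.1),
      ← map_mul, ← map_mul, ← map_mul, ← map_add] at hred'

theorem HasShell.add_div [CharZero F] {u v : F[X]} (hsr : shiftReducedPair u v) (D : F[X]) :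
    D ≠ 0 → ∀ S : RatFunc F, HasShell u v S → ∀ c : F[X],
      HasShell u v (S + algebraMap F[X] (RatFunc F) c / algebraMap F[X] (RatFunc F) D) := by
  induction D using UniqueFactorizationMonoid.induction_on_coprime with
  | h0 => exact fun h => absurd rfl h
  | h1 hx =>
    intro hD S hS c
    obtain ⟨y, hy⟩ := hx.exists_right_inv
    have hD' := algebraMap_ratFunc_ne_zero hD
    have hy' := congrArg (algebraMap F[X] (RatFunc F)) hy
    simp only [map_mul, map_one] at hy'
    convert hS.add_algebraMap hsr.2.1 (c * y) using 2
    rw [div_eq_iff hD', map_mul, mul_assoc, mul_comm (algebraMap F[X] (RatFunc F) y), hy', mul_one]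
  | hpr m hp => exact fun _ S hS c => hS.add_div_pow hsr hp.irreducible m c
  | @hcp x y hxy hx hy =>
    intro hD S hS c
    have hx0 := left_ne_zero_of_mul hD
    have hy0 := right_ne_zero_of_mul hD
    obtain ⟨r, s, hrs⟩ := hxy.isCoprime
    have hrs' := congrArg (algebraMap F[X] (RatFunc F)) hrs
    simp only [map_add, map_mul, map_one] at hrs'
    have hx' := algebraMap_ratFunc_ne_zero hx0
    have hy' := algebraMap_ratFunc_ne_zero hy0
    convert hy hy0 _ (hx hx0 S hS (c * s)) (c * r) using 1
    simp only [map_mul]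
    field_simp
    linear_combination (-(algebraMap F[X] (RatFunc F) c)) * hrs'

theorem hasShell [CharZero F] {u v : F[X]} (hsr : shiftReducedPair u v) (S : RatFunc F) :
    HasShell u v S := by
  have h0 : HasShell u v (0 : RatFunc F) :=
    ⟨0, 1, shiftFree_one, stronglyPrime_one u v, by simpa using ReducesTo.refl u v 0⟩
  simpa [RatFunc.num_div_denom] using
    HasShell.add_div hsr S.denom S.denom_ne_zero 0 h0 S.num

end RationalShift

section PolynomialPart

variable {F : Type*} [Field F]

theorem phiK_add (u v p q : F[X]) : phiK u v (p + q) = phiK u v p + phiK u v q := by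
  simp only [phiK, map_add]; ring

theorem phiK_C_mul (u v : F[X]) (c : F) (p : F[X]) : phiK u v (C c * p) = C c * phiK u v p := by
  have : pshift F 1 (C c) = C c := by simp [pshift_eq_taylor]
  simp only [phiK, map_mul, this]; ring

theorem exists_phiK_add_WK (u v q : F[X]) : ∃ p, ∃ w ∈ WK F u v, q = phiK u v p + w := by
  induction hd : q.degree using WellFoundedLT.induction generalizing q with
  | ind d ih =>
    by_cases hq : q = 0
    · exact ⟨0, 0, zero_mem _, by simp [hq, phiK]⟩
    by_cases h : ∃ p, phiK u v p ≠ 0 ∧ q.natDegree = (phiK u v p).natDegree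
    · obtain ⟨p, hp, hdeg⟩ := h
      set c := q.leadingCoeff / (phiK u v p).leadingCoeff with hc
      have hc0 : c ≠ 0 := div_ne_zero (leadingCoeff_ne_zero.2 hq) (leadingCoeff_ne_zero.2 hp)
      have hlt : (q - C c * phiK u v p).degree < q.degree := by
        refine degree_sub_lt_left ?_ hq ?_
        · rw [degree_C_mul hc0, degree_eq_natDegree hq, degree_eq_natDegree hp, hdeg]
        · rw [leadingCoeff_mul, leadingCoeff_C, hc,
            div_mul_cancel₀ _ (leadingCoeff_ne_zero.2 hp)]
      obtain ⟨p', w, hw, hpw⟩ := ih _ (hd ▸ hlt) _ rfl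
      refine ⟨p' + C c * p, w, hw, ?_⟩
      rw [phiK_add, phiK_C_mul]
      linear_combination hpw
    · push Not at h
      have hmem : (X : F[X]) ^ q.natDegree ∈ WK F u v := by
        refine Submodule.subset_span ⟨_, rfl, ?_⟩
        rintro _ ⟨p, rfl⟩ hne
        exact h p hne
      have hlt : (q - C q.leadingCoeff * X ^ q.natDegree).degree < q.degree := by
        refine degree_sub_lt_left ?_ hq ?_
        · rw [degree_C_mul_X_pow _ (leadingCoeff_ne_zero.2 hq), degree_eq_natDegree hq]
        · simp
      obtain ⟨p', w, hw, hpw⟩ := ih _ (hd ▸ hlt) _ rfl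
      refine ⟨p', w + q.leadingCoeff • X ^ q.natDegree,
        add_mem hw (Submodule.smul_mem _ _ hmem), ?_⟩
      rw [smul_eq_C_mul]
      linear_combination hpw

theorem coeff_eq_zero_of_mem_WK {u v w : F[X]} (hw : w ∈ WK F u v) {p : F[X]}
    (hp : phiK u v p ≠ 0) : w.coeff (phiK u v p).natDegree = 0 := by
  induction hw using Submodule.span_induction with
  | mem x hx =>
    obtain ⟨l, rfl, hl⟩ := hx
    rw [coeff_X_pow, if_neg (hl _ ⟨p, rfl⟩ hp).symm]
  | zero => simp
  | add x y _ _ hx hy => rw [coeff_add, hx, hy, add_zero]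
  | smul c x _ hx => rw [coeff_smul, hx, smul_zero]

theorem phiK_eq_zero_of_mem_WK {u v p : F[X]} (hw : phiK u v p ∈ WK F u v) :
    phiK u v p = 0 := by
  by_contra h
  exact leadingCoeff_ne_zero.2 h (coeff_eq_zero_of_mem_WK hw h)

end PolynomialPart

section Decomposition

variable {F : Type*} [Field F]

theorem exists_residualForm_decomposition [CharZero F] {u v : F[X]}
    (hsr : shiftReducedPair u v) (S : RatFunc F) : ∃ f r : RatFunc F, residualForm u v r ∧
      S = RatFunc.mk u v * rshift F 1 f - f + r := by
  obtain ⟨a, b, hb, hbs, f, q, hS⟩ := hasShell hsr S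
  obtain ⟨p, w, hw, hpw⟩ := exists_phiK_add_WK u v (q + a / b * v)
  have hv' := algebraMap_ratFunc_ne_zero hsr.2.1
  have hb' := algebraMap_ratFunc_ne_zero hb.1
  refine ⟨f + algebraMap F[X] (RatFunc F) p, _,
    ⟨a % b, b, w, EuclideanDomain.mod_lt a hb.1, hb, hbs, hw, rfl⟩, ?_⟩
  have hdiv := congrArg (algebraMap F[X] (RatFunc F)) (EuclideanDomain.div_add_mod a b)
  have hpw' := congrArg (algebraMap F[X] (RatFunc F)) hpw
  simp only [phiK, map_add, map_mul, map_sub] at hdiv hpw'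
  simp only [hS, rshift_one_eq_ratShift, RatFunc.mk_eq_div, map_add, ratShift_algebraMap]
  rw [← hdiv]
  field_simp
  linear_combination algebraMap F[X] (RatFunc F) b * hpw'

/-- The denominator of a solution of `K * σ g - g = a / b + q / v` is constant, by comparing the
extremal shifts of its irreducible factors. -/
theorem isUnit_of_telescoping [CharZero F] {u v a b q s t : F[X]} (hsr : shiftReducedPair u v)
    (hb : shiftFree b) (hbs : stronglyPrime b u v) (hst : IsCoprime s t) (ht : t ≠ 0)
    (h : u * pshift F 1 s * t * b - v * s * pshift F 1 t * b =
      (v * a + q * b) * pshift F 1 t * t) : IsUnit t := by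
  by_contra hunit
  obtain ⟨p, hp, hpt⟩ := WfDvdMonoid.exists_irreducible_factor hunit ht
  obtain ⟨M, hM0, hM, hMmax⟩ := exists_max_pshift_dvd hp ht hpt
  obtain ⟨m, hm0, hm, hmmin⟩ := exists_min_pshift_dvd hp ht hpt
  have hirr : ∀ i : ℤ, Irreducible (pshift F i p) := fun i => irreducible_pshift i hp
  have hnot : ∀ {i : ℤ} {x y : F[X]}, IsCoprime x y → pshift F i p ∣ x → ¬ pshift F i p ∣ y :=
    fun hxy hx hy => (hirr _).not_isUnit (hxy.isUnit_of_dvd' hx hy)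
  have hshift : ∀ {i : ℤ} (j : ℤ) {x : F[X]}, pshift F i p ∣ x →
      pshift F (j + i) p ∣ pshift F j x := fun j x hx => by
    rw [← pshift_pshift]; exact pshift_dvd_pshift j hx
  have hMσ : pshift F (1 + M) p ∣ pshift F 1 t := hshift 1 hM
  have hmσ : ¬ pshift F m p ∣ pshift F 1 t := fun hd => by
    refine hmmin (-1 + m) (by omega) ?_
    simpa [pshift_pshift, pshift_zero] using hshift (-1) hd
  have hright : pshift F (1 + M) p ∣ u ∨ pshift F (1 + M) p ∣ b := by
    have hd : pshift F (1 + M) p ∣ u * pshift F 1 s * t * b := by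
      have : u * pshift F 1 s * t * b =
          pshift F 1 t * (v * s * b + (v * a + q * b) * t) := by linear_combination h
      rw [this]; exact hMσ.mul_right _
    rcases (hirr _).prime.dvd_or_dvd hd with hd | hd
    · rcases (hirr _).prime.dvd_or_dvd hd with hd | hd
      · rcases (hirr _).prime.dvd_or_dvd hd with hd | hd
        · exact .inl hd
        · exact absurd hMσ (hnot (hst.pshift 1) hd)
      · exact absurd hd (hMmax _ (by omega))
    · exact .inr hd
  have hleft : pshift F m p ∣ v ∨ pshift F m p ∣ b := by
    have hd : pshift F m p ∣ v * s * pshift F 1 t * b := by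
      have : v * s * pshift F 1 t * b =
          t * (u * pshift F 1 s * b - (v * a + q * b) * pshift F 1 t) := by
        linear_combination -h
      rw [this]; exact hm.mul_right _
    rcases (hirr _).prime.dvd_or_dvd hd with hd | hd
    · rcases (hirr _).prime.dvd_or_dvd hd with hd | hd
      · rcases (hirr _).prime.dvd_or_dvd hd with hd | hd
        · exact .inl hd
        · exact absurd hm (hnot hst hd)
      · exact absurd hd hmσ
    · exact .inr hd
  obtain ⟨k, hk⟩ : ∃ k : ℕ, (k : ℤ) = 1 + M - m := ⟨(1 + M - m).toNat, by omega⟩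
  have hup : (k : ℤ) + m = 1 + M := by omega
  have hdown : -(k : ℤ) + (1 + M) = m := by omega
  rcases hright with hr | hr <;> rcases hleft with hl | hl
  · exact hnot (hsr.2.2.2 k) hr (hup ▸ hshift k hl)
  · exact hnot (hbs.2 k).1 hl (by simpa only [hdown] using hshift (-(k : ℤ)) hr)
  · exact hnot (hbs.2 k).2 hr (by simpa only [hup] using hshift (k : ℤ) hl)
  · exact hnot (hb.2 k (by omega)) hr (by simpa only [hup] using hshift (k : ℤ) hl)

theorem residualForm.eq_zero_of_mem_VK [CharZero F] {u v : F[X]} (hsr : shiftReducedPair u v)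
    {r : RatFunc F} (hr : residualForm u v r) (hV : r ∈ VK (RatFunc.mk u v)) : r = 0 := by
  obtain ⟨a, b, q, hab, hb, hbs, hq, hreq⟩ := hr
  obtain ⟨g, hg⟩ := hV
  have hv' := algebraMap_ratFunc_ne_zero hsr.2.1
  have hb' := algebraMap_ratFunc_ne_zero hb.1
  have hinj := RatFunc.algebraMap_injective F
  have heq := hreq.symm.trans hg
  rw [rshift_one_eq_ratShift] at heq
  simp only [RatFunc.mk_eq_div] at heq
  obtain ⟨p, rfl⟩ : ∃ p : F[X], g = algebraMap F[X] (RatFunc F) p := by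
    obtain ⟨s, t, hst, ht, rfl⟩ : ∃ s t : F[X], IsCoprime s t ∧ t ≠ 0 ∧
        g = algebraMap F[X] (RatFunc F) s / algebraMap F[X] (RatFunc F) t :=
      ⟨g.num, g.denom, g.isCoprime_num_denom, g.denom_ne_zero, g.num_div_denom.symm⟩
    have ht' := algebraMap_ratFunc_ne_zero ht
    have hσt' := algebraMap_ratFunc_ne_zero (pshift_ne_zero 1 ht)
    have hunit : IsUnit t := by
      refine isUnit_of_telescoping (a := a) (q := q) hsr hb hbs hst ht (hinj ?_)
      simp only [map_div₀, ratShift_algebraMap] at heq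
      simp only [map_mul, map_sub, map_add]
      field_simp at heq
      linear_combination -heq
    obtain ⟨y, hy⟩ := hunit.exists_right_inv
    refine ⟨s * y, ?_⟩
    rw [div_eq_iff ht', ← map_mul, mul_assoc, mul_comm y, hy, mul_one]
  rw [ratShift_algebraMap] at heq
  have hpoly : v * a + q * b = phiK u v p * b := hinj <| by
    simp only [phiK, map_mul, map_sub, map_add]
    field_simp at heq
    linear_combination heq
  have hba : b ∣ a := by
    have hcop : IsCoprime b v := by simpa [pshift_zero] using (hbs.2 0).2
    refine hcop.dvd_of_dvd_mul_left ⟨phiK u v p - q, ?_⟩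
    linear_combination hpoly
  obtain rfl : a = 0 := eq_zero_of_dvd_of_degree_lt hba hab
  obtain rfl : q = phiK u v p := mul_right_cancel₀ hb.1 (by linear_combination hpoly)
  rw [hreq, phiK_eq_zero_of_mem_WK hq]
  simp [RatFunc.mk_eq_div]

end Decomposition

/-- Every S ∈ F(y) decomposes as S = K·σ(f) − f + r with r a residual form,
and S ∈ V_K iff r = 0. -/
theorem stmt13 {F : Type*} [Field F] [CharZero F] (u v : Polynomial F) (S : RatFunc F)
    (hsr : shiftReducedPair u v) (hK1 : RatFunc.mk u v ≠ 1) :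
    ∃ f r : RatFunc F, residualForm u v r ∧
      S = RatFunc.mk u v * rshift F 1 f - f + r ∧
      (S ∈ VK (RatFunc.mk u v) ↔ r = 0) := by
  obtain ⟨f, r, hr, hS⟩ := exists_residualForm_decomposition hsr S
  refine ⟨f, r, hr, hS, fun ⟨g, hg⟩ => hr.eq_zero_of_mem_VK hsr ⟨g - f, ?_⟩, fun h => ⟨f, ?_⟩⟩
  · simp only [rshift_one_eq_ratShift, map_sub] at hS hg ⊢
    linear_combination hg - hS
  · rw [hS, h, add_zero]
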